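/- arXiv:2304.10797 — 2 statements merged into one kernel-verified Lean document; each statement's English description precedes it below -/
import Mathlib

section
/- For every x > 0 and a ∈ ℝ, the function g(v) := K₀(x·v; a) on v > 0 satisfies the inhomogeneous differential equation v·g''(v) + g'(v) − x²·v·g(v) = x·sinh(a)·exp(−x·v·cosh(a)) for all v > 0. -/
open Real MeasureTheory

/-- `K₀(x) = ∫₀^∞ exp(-x cosh T) dT` for `x > 0` (the Lean integral is `0` at `x = 0`,
matching the convention `K₀(0) := 0`). -/
noncomputable def K0 (x : ℝ) : ℝ := ∫ T in Set.Ioi (0:ℝ), Real.exp (-x * Real.cosh T)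

/-- The incomplete version `K₀(x; a) = sgn(a) ∫_{|a|}^∞ exp(-x cosh T) dT`. -/
noncomputable def K0inc (x a : ℝ) : ℝ :=
  Real.sign a * ∫ T in Set.Ioi |a|, Real.exp (-x * Real.cosh T)

lemma K0aux_bound (n : ℕ) (y : ℝ) (hy : 0 < y) (T : ℝ) :
    Real.cosh T ^ n * Real.exp (-y * Real.cosh T)
      ≤ (2 * ((n+1).factorial / y^(n+1))) * Real.exp (-T) := by
  have hc : 0 < Real.cosh T := Real.cosh_pos T
  have h1 := Real.pow_div_factorial_le_exp (y * Real.cosh T) (by positivity) (n+1)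
  have h2 : Real.exp T / 2 ≤ Real.cosh T := by
    rw [Real.cosh_eq]; have := Real.exp_pos (-T); linarith
  have hf : (0:ℝ) < (n+1).factorial := by positivity
  rw [div_le_iff₀ hf, mul_pow] at h1
  rw [neg_mul, Real.exp_neg, Real.exp_neg]
  have he := Real.exp_pos (y * Real.cosh T)
  have heT := Real.exp_pos T
  have key : Real.cosh T ^ n * Real.exp T * y^(n+1)
      ≤ 2 * (n+1).factorial * Real.exp (y * Real.cosh T) := by
    calc Real.cosh T ^ n * Real.exp T * y^(n+1)
        ≤ Real.cosh T ^ n * (2 * Real.cosh T) * y^(n+1) := by gcongr; linarith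
      _ = 2 * (y^(n+1) * Real.cosh T^(n+1)) := by ring
      _ ≤ _ := by linarith
  have hyn : 0 < y^(n+1) := by positivity
  rw [← div_eq_mul_inv, ← div_eq_mul_inv, div_le_div_iff₀ he heT, ← mul_div_assoc,
    div_mul_eq_mul_div, le_div_iff₀ hyn]
  exact key

lemma K0aux_int (n : ℕ) (y : ℝ) (hy : 0 < y) (b : ℝ) :
    Integrable (fun T => Real.cosh T ^ n * Real.exp (-y * Real.cosh T))
      (volume.restrict (Set.Ioi b)) := by
  have hexp : Integrable (fun T : ℝ => Real.exp (-T)) (volume.restrict (Set.Ioi b)) :=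
    integrableOn_exp_neg_Ioi b
  refine (hexp.const_mul (2 * ((n+1).factorial / y^(n+1)))).mono' ?_ ?_
  · exact Continuous.aestronglyMeasurable (by fun_prop)
  · refine Filter.Eventually.of_forall fun T => ?_
    have hc : 0 < Real.cosh T := Real.cosh_pos T
    rw [Real.norm_of_nonneg (by positivity)]
    exact K0aux_bound n y hy T

lemma K0aux_deriv (n : ℕ) (y : ℝ) (hy : 0 < y) (b : ℝ) :
    HasDerivAt (fun y => ∫ T in Set.Ioi b, Real.cosh T ^ n * Real.exp (-y * Real.cosh T))
      (-∫ T in Set.Ioi b, Real.cosh T ^ (n+1) * Real.exp (-y * Real.cosh T)) y := by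
  rw [← integral_neg]
  refine (hasDerivAt_integral_of_dominated_loc_of_deriv_le (s := Set.Ioi (y/2))
    (F := fun y T => Real.cosh T ^ n * Real.exp (-y * Real.cosh T))
    (F' := fun y T => -(Real.cosh T ^ (n+1) * Real.exp (-y * Real.cosh T)))
    (bound := fun T => Real.cosh T ^ (n+1) * Real.exp (-(y/2) * Real.cosh T))
    (Ioi_mem_nhds (by linarith)) ?_ (K0aux_int n y hy b) ?_ ?_
    (K0aux_int (n+1) (y/2) (by linarith) b) ?_).2
  · exact Filter.Eventually.of_forall fun z => Continuous.aestronglyMeasurable (by fun_prop)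
  · exact Continuous.aestronglyMeasurable (by fun_prop)
  · refine Filter.Eventually.of_forall fun T z hz => ?_
    have hc : 0 < Real.cosh T := Real.cosh_pos T
    have hz' : y/2 < z := hz
    rw [norm_neg, Real.norm_of_nonneg (by positivity)]
    gcongr
  · refine Filter.Eventually.of_forall fun T z hz => ?_
    have h := ((((hasDerivAt_id z).neg).mul_const (Real.cosh T)).exp).const_mul (Real.cosh T ^ n)
    refine HasDerivAt.congr_deriv (f := fun z => Real.cosh T ^ n * Real.exp (-z * Real.cosh T)) h ?_
    simp only [id, Pi.neg_apply]
    ring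

lemma K0aux_ibp (y : ℝ) (hy : 0 < y) (b : ℝ) :
    ∫ T in Set.Ioi b, (Real.cosh T ^ 1 * Real.exp (-y * Real.cosh T)
      - y * (Real.cosh T ^ 2 * Real.exp (-y * Real.cosh T)
        - Real.cosh T ^ 0 * Real.exp (-y * Real.cosh T)))
      = 0 - Real.sinh b * Real.exp (-y * Real.cosh b) := by
  refine integral_Ioi_of_hasDerivAt_of_tendsto'
    (f := fun T => Real.sinh T * Real.exp (-y * Real.cosh T)) ?_ ?_ ?_
  · intro T _
    have h := (Real.hasDerivAt_sinh T).mul (((Real.hasDerivAt_cosh T).const_mul (-y)).exp)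
    refine HasDerivAt.congr_deriv (f := fun T => Real.sinh T * Real.exp (-y * Real.cosh T)) h ?_
    have := Real.cosh_sq T
    rw [this]; ring
  · exact (K0aux_int 1 y hy b).sub (((K0aux_int 2 y hy b).sub (K0aux_int 0 y hy b)).const_mul y)
  · have hlim : Filter.Tendsto (fun T : ℝ => (2 * (((1+1).factorial : ℝ) / y^(1+1))) * Real.exp (-T))
        Filter.atTop (nhds 0) := by
      have h := (Real.tendsto_exp_neg_atTop_nhds_zero).const_mul
        (2 * (((1+1).factorial : ℝ) / y^(1+1)))
      rwa [mul_zero] at h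
    refine squeeze_zero_norm (fun T => ?_) hlim
    refine le_trans ?_ (K0aux_bound 1 y hy T)
    rw [norm_mul, Real.norm_of_nonneg (Real.exp_pos _).le, pow_one]
    gcongr
    rw [Real.norm_eq_abs, Real.abs_sinh, ← Real.cosh_abs]
    exact (Real.sinh_lt_cosh _).le

/-- For `x > 0`, `a ∈ ℝ`, the function `g(v) = K₀(xv; a)` satisfies
`v g''(v) + g'(v) − x² v g(v) = x sinh(a) e^{−xv cosh(a)}` for `v > 0`. -/
theorem K0inc_inhomogeneous_ode (x : ℝ) (hx : 0 < x) (a : ℝ) (v : ℝ) (hv : 0 < v) :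
    v * deriv (deriv (fun v' : ℝ => K0inc (x * v') a)) v
      + deriv (fun v' : ℝ => K0inc (x * v') a) v
      - x^2 * v * K0inc (x * v) a
      = x * Real.sinh a * Real.exp (-(x * v * Real.cosh a)) := by
  set J : ℕ → ℝ → ℝ := fun n y =>
    ∫ T in Set.Ioi |a|, Real.cosh T ^ n * Real.exp (-y * Real.cosh T) with hJ
  have hK : ∀ y, K0inc y a = Real.sign a * J 0 y := by
    intro y; simp [K0inc, hJ]
  have hd : ∀ n w, 0 < w → HasDerivAt (fun w => J n (x * w)) (-(J (n+1) (x * w)) * x) w := by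
    intro n w hw
    have h1 : HasDerivAt (fun w : ℝ => x * w) x w := by
      simpa using (hasDerivAt_id w).const_mul x
    exact (K0aux_deriv n (x * w) (by positivity) |a|).comp w h1
  have hD1 : ∀ w, 0 < w → deriv (fun v' : ℝ => K0inc (x * v') a) w
      = Real.sign a * (-(J 1 (x * w)) * x) := by
    intro w hw
    simp only [hK]
    exact ((hd 0 w hw).const_mul _).deriv
  have hD2 : deriv (deriv (fun v' : ℝ => K0inc (x * v') a)) v
      = Real.sign a * (-(-(J 2 (x * v)) * x) * x) := by
    have he : deriv (fun v' : ℝ => K0inc (x * v') a) =ᶠ[nhds v]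
        fun w => Real.sign a * (-(J 1 (x * w)) * x) :=
      Filter.eventually_of_mem (Ioi_mem_nhds hv) fun w hw => hD1 w hw
    rw [he.deriv_eq]
    exact ((((hd 1 v hv).neg).mul_const x).const_mul _).deriv
  rw [hD2, hD1 v hv, hK]
  have hy : 0 < x * v := by positivity
  have hI := K0aux_ibp (x * v) hy |a|
  have i0 := K0aux_int 0 (x * v) hy |a|
  have i1 := K0aux_int 1 (x * v) hy |a|
  have i2 := K0aux_int 2 (x * v) hy |a|
  have i3 : Integrable (fun T => x * v * (Real.cosh T ^ 2 * Real.exp (-(x * v) * Real.cosh T)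
      - Real.cosh T ^ 0 * Real.exp (-(x * v) * Real.cosh T)))
      (volume.restrict (Set.Ioi |a|)) := (i2.sub i0).const_mul _
  rw [integral_sub i1 i3, integral_const_mul, integral_sub i2 i0] at hI
  change J 1 (x * v) - x * v * (J 2 (x * v) - J 0 (x * v)) = _ at hI
  rw [Real.cosh_abs] at hI
  have hs : Real.sign a * Real.sinh |a| = Real.sinh a := by
    rcases lt_trichotomy a 0 with h | h | h
    · rw [Real.sign_of_neg h, abs_of_neg h, Real.sinh_neg]; ring
    · subst h; simp
    · rw [Real.sign_of_pos h, abs_of_pos h]; ring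
  rw [← hs, ← neg_mul (x * v)]
  linear_combination (-(x * Real.sign a)) * hI
end

section
/- Let λ = (λ₁,λ₂) ∈ ℝ² be fixed and define f(u,v,t) := φ_{u+iv}(λ_t^+, λ_t^−) for u ∈ ℝ, v > 0, t > 0. Then 4·Δ̃f = (t·∂_t)²f, i.e. 4(v²(∂_u² + ∂_v²)f + f/4) = t·∂_t(t·∂_t f), at every point with v > 0 and t > 0. (This is the termwise form of the differential operator relation 4Δ̃θ = (t∂_t)²θ for the Siegel theta kernel.) -/
open Real MeasureTheory

/-- The hyperbolic quadratic form `Q₀((x₁,x₂)) = x₁x₂` on `ℝ²`. -/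
def Q0 (w : ℝ × ℝ) : ℝ := w.1 * w.2

/-- `λ_t⁺ = (λ₁ t⁻¹ + λ₂ t)/2`. -/
noncomputable def lamP (w : ℝ × ℝ) (t : ℝ) : ℝ := (w.1 / t + w.2 * t) / 2

/-- `λ_t⁻ = (−λ₁ t⁻¹ + λ₂ t)/2`. -/
noncomputable def lamM (w : ℝ × ℝ) (t : ℝ) : ℝ := (-w.1 / t + w.2 * t) / 2

/-- Zwegers' function `β_{t₀}(w)`. -/
noncomputable def betaF (t₀ : ℝ) (w : ℝ × ℝ) : ℝ :=
  if 0 < lamM w t₀ * lamP w t₀ then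
    Real.exp (-(2 * π * Q0 w)) * ∫ t in Set.Ioi t₀, Real.exp (-(4 * π * (lamM w t)^2)) / t
  else if lamM w t₀ * lamP w t₀ < 0 then
    -(Real.exp (-(2 * π * Q0 w)) * ∫ t in Set.Ioc (0:ℝ) t₀, Real.exp (-(4 * π * (lamM w t)^2)) / t)
  else 0

/-- The coefficient `a_λ(t₁,t₂)` (for `Q₀(λ) ≠ 0`). -/
noncomputable def aCoef (t₁ t₂ : ℝ) (w : ℝ × ℝ) : ℝ :=
  if Q0 w < 0 then (1 - Real.sign (lamP w t₁ * lamP w t₂)) / 2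
  else (1 - Real.sign (lamM w t₁ * lamM w t₂)) / 2
/-- `φ_{u+iv}(x,y) = √v · e(x²τ − y²τ̄)` with `τ = u + iv`. -/
noncomputable def phiKer (x y u v : ℝ) : ℂ :=
  (Real.sqrt v : ℂ) * Complex.exp (2 * (π:ℂ) * Complex.I *
    ((x:ℂ)^2 * ((u:ℂ) + (v:ℂ) * Complex.I) - (y:ℂ)^2 * ((u:ℂ) - (v:ℂ) * Complex.I)))

lemma aux_u (x y u v : ℝ) : HasDerivAt (fun u' : ℝ => phiKer x y u' v)
    ((2 * (π:ℂ) * Complex.I * ((x:ℂ)^2 - (y:ℂ)^2)) * phiKer x y u v) u := by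
  unfold phiKer
  have h0 : HasDerivAt (fun z : ℝ => (z:ℂ)) 1 u := Complex.ofRealCLM.hasDerivAt
  have h1 := ((((h0.add_const ((v:ℂ) * Complex.I)).const_mul ((x:ℂ)^2)).sub
    ((h0.sub_const ((v:ℂ) * Complex.I)).const_mul ((y:ℂ)^2))).const_mul
      (2 * (π:ℂ) * Complex.I)).cexp.const_mul ((Real.sqrt v : ℝ) : ℂ)
  refine h1.congr_deriv ?_
  simp only [Pi.sub_apply]
  ring

lemma aux_v (x y u v : ℝ) (hv : 0 < v) : HasDerivAt (fun v' : ℝ => phiKer x y u v')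
    ((1 / (2 * (v:ℂ)) - 2 * (π:ℂ) * ((x:ℂ)^2 + (y:ℂ)^2)) * phiKer x y u v) v := by
  unfold phiKer
  have h0 : HasDerivAt (fun z : ℝ => (z:ℂ)) 1 v := Complex.ofRealCLM.hasDerivAt
  have hs := (Real.hasDerivAt_sqrt hv.ne').ofReal_comp
  have h1 := hs.mul (((((h0.mul_const Complex.I).const_add (u:ℂ)).const_mul ((x:ℂ)^2)).sub
    (((h0.mul_const Complex.I).const_sub (u:ℂ)).const_mul ((y:ℂ)^2))).const_mul
      (2 * (π:ℂ) * Complex.I)).cexp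
  refine h1.congr_deriv ?_
  simp only [Pi.sub_apply]
  have hsq : ((Real.sqrt v : ℝ) : ℂ) ≠ 0 := by
    exact_mod_cast (Real.sqrt_pos.2 hv).ne'
  have hvv : (v:ℂ) = ((Real.sqrt v : ℝ) : ℂ)^2 := by
    exact_mod_cast (Real.sq_sqrt hv.le).symm
  have hk : ((1 / (2 * Real.sqrt v) : ℝ) : ℂ)
      = 1 / (2 * (v:ℂ)) * ((Real.sqrt v : ℝ) : ℂ) := by
    push_cast
    rw [hvv]
    field_simp
  rw [hk]
  ring_nf
  simp only [Complex.I_sq]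
  ring

lemma aux_t (a b u v t : ℝ) (ht : 0 < t) :
    HasDerivAt (fun s : ℝ => phiKer (lamP (a, b) s) (lamM (a, b) s) u v)
    ((-(2 * (π:ℂ) * v) * ((b:ℂ)^2 * t - (a:ℂ)^2 / (t:ℂ)^3)) *
      phiKer (lamP (a, b) t) (lamM (a, b) t) u v) t := by
  unfold phiKer
  have ht' : (t:ℂ) ≠ 0 := by exact_mod_cast ht.ne'
  have h0 : HasDerivAt (fun z : ℝ => z) 1 t := hasDerivAt_id t
  have hi := (hasDerivAt_inv ht.ne')
  have hP : HasDerivAt (fun s : ℝ => lamP (a, b) s) ((a * (-(t^2)⁻¹) + b * 1) / 2) t := by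
    simp only [lamP, div_eq_mul_inv a]
    exact ((hi.const_mul a).add (h0.const_mul b)).div_const 2
  have hM : HasDerivAt (fun s : ℝ => lamM (a, b) s) ((-a * (-(t^2)⁻¹) + b * 1) / 2) t := by
    simp only [lamM, div_eq_mul_inv (-a)]
    exact ((hi.const_mul (-a)).add (h0.const_mul b)).div_const 2
  have h1 := ((((hP.ofReal_comp.pow 2).mul_const ((u:ℂ) + (v:ℂ) * Complex.I)).sub
    ((hM.ofReal_comp.pow 2).mul_const ((u:ℂ) - (v:ℂ) * Complex.I))).const_mul
      (2 * (π:ℂ) * Complex.I)).cexp.const_mul ((Real.sqrt v : ℝ) : ℂ)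
  refine h1.congr_deriv ?_
  simp only [Pi.sub_apply, Pi.pow_apply]
  generalize hE : Complex.exp _ = E
  clear hE h1
  simp only [lamP, lamM]
  push_cast
  field_simp
  ring_nf
  simp only [Complex.I_sq]
  ring

/-- The termwise differential operator relation `4Δ̃f = (t∂_t)²f` for the
Siegel theta kernel term `f(u,v,t) = φ_{u+iv}(λ_t⁺, λ_t⁻)`. -/
theorem theta_kernel_diffop_relation (lam : ℝ × ℝ) (u v t : ℝ) (hv : 0 < v) (ht : 0 < t) :
    4 * ((v:ℂ)^2 * (deriv (fun u' : ℝ =>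
            deriv (fun u'' : ℝ => phiKer (lamP lam t) (lamM lam t) u'' v) u') u
          + deriv (fun v' : ℝ =>
            deriv (fun v'' : ℝ => phiKer (lamP lam t) (lamM lam t) u v'') v') v)
        + phiKer (lamP lam t) (lamM lam t) u v / 4)
      = (t:ℂ) * deriv (fun t' : ℝ => (t':ℂ) *
          deriv (fun s : ℝ => phiKer (lamP lam s) (lamM lam s) u v) t') t := by
  obtain ⟨a, b⟩ := lam
  have ht' : (t:ℂ) ≠ 0 := by exact_mod_cast ht.ne'
  have hv' : (v:ℂ) ≠ 0 := by exact_mod_cast hv.ne'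
  have h0 (z : ℝ) : HasDerivAt (fun z : ℝ => (z:ℂ)) 1 z := Complex.ofRealCLM.hasDerivAt
  have hu : (fun u' : ℝ => deriv (fun u'' : ℝ => phiKer (lamP (a, b) t) (lamM (a, b) t) u'' v) u')
      = fun u' => _ := funext fun u' => (aux_u _ _ u' v).deriv
  rw [hu, ((aux_u _ _ u v).const_mul _).deriv]
  have hvE : (fun v' : ℝ => deriv (fun v'' : ℝ => phiKer (lamP (a, b) t) (lamM (a, b) t) u v'') v')
      =ᶠ[nhds v] fun v' => (1 / (2 * (v':ℂ)) - 2 * (π:ℂ) * ((lamP (a, b) t:ℂ)^2 +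
        (lamM (a, b) t:ℂ)^2)) * phiKer (lamP (a, b) t) (lamM (a, b) t) u v' := by
    filter_upwards [lt_mem_nhds hv] with z hz using (aux_v _ _ u z hz).deriv
  have h2v : (2 * (v:ℂ)) ≠ 0 := by simpa using hv'
  have hv2 := hvE.deriv_eq.trans (((((hasDerivAt_const v (1:ℂ)).div ((h0 v).const_mul 2) h2v)).sub_const
    (2 * (π:ℂ) * ((lamP (a, b) t:ℂ)^2 + (lamM (a, b) t:ℂ)^2))).mul (aux_v (lamP (a, b) t) (lamM (a, b) t) u v hv)).deriv
  rw [hv2]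
  have htE : (fun t' : ℝ => (t':ℂ) *
      deriv (fun s : ℝ => phiKer (lamP (a, b) s) (lamM (a, b) s) u v) t')
      =ᶠ[nhds t] fun t' => (-(2 * (π:ℂ) * v) * ((b:ℂ)^2 * (t':ℂ)^2 - (a:ℂ)^2 / (t':ℂ)^2)) *
      phiKer (lamP (a, b) t') (lamM (a, b) t') u v := by
    filter_upwards [lt_mem_nhds ht] with z hz
    have hz' : (z:ℂ) ≠ 0 := by exact_mod_cast hz.ne'
    rw [(aux_t a b u v z hz).deriv]
    field_simp
  have ht2 := htE.deriv_eq.trans ((((((h0 t).pow 2).const_mul ((b:ℂ)^2)).sub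
    ((hasDerivAt_const t ((a:ℂ)^2)).div ((h0 t).pow 2) (pow_ne_zero 2 ht'))).const_mul
      (-(2 * (π:ℂ) * v))).mul (aux_t a b u v t ht)).deriv
  rw [ht2]
  simp only [Pi.sub_apply, Pi.pow_apply, Pi.div_apply]
  generalize phiKer (lamP (a, b) t) (lamM (a, b) t) u v = F
  simp only [lamP, lamM]
  push_cast
  field_simp
  ring_nf
  simp only [Complex.I_sq]
  ring
end
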